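/- The Hessian matrix of F at the point (1/2, 3/2, 1/2) (a real symmetric 3×3 matrix) has exactly one positive eigenvalue and exactly two negative eigenvalues; equivalently, the Einstein metric g5 = (1/2, 3/2, 1, 1/2) is a non-degenerate unstable critical point of the normalized scalar curvature with coindex 1. -/

import Mathlib

open Real

/-- Scalar curvature of the invariant metric `g = (x1,x2,x3,x4)` on `M = H×H/ΔK`,
where `d = dim K` and `n = dim H/K`. -/
noncomputable def Scal (d n x1 x2 x3 x4 : ℝ) : ℝ :=
  d / (2 * x3) -
    n * (x2 ^ 2 * x3 ^ 2 + x1 ^ 2 * (4 * x2 ^ 2 - 8 * x2 * x3 + x3 ^ 2)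
        + 8 * x2 * x3 * x4 ^ 2 + 8 * x1 * x3 * (x4 ^ 2 - x2 ^ 2)
        - 2 * x4 ^ 2 * (x3 ^ 2 + 2 * x4 ^ 2)) /
      (16 * x3 * (x4 ^ 2 - x1 * x2) ^ 2)

/-- Normalized scalar curvature `F(x1,x2,x4) = Scal(x1,x2,1,x4)·(x1·x2 − x4²)^{n/(d+2n)}`. -/
noncomputable def F (d n x1 x2 x4 : ℝ) : ℝ :=
  Scal d n x1 x2 1 x4 * (x1 * x2 - x4 ^ 2) ^ (n / (d + 2 * n))

/-- Partial derivative of a function of three real variables in the `i`-th variable. -/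
noncomputable def pd (i : Fin 3) (f : ℝ → ℝ → ℝ → ℝ) : ℝ → ℝ → ℝ → ℝ :=
  ![fun x y z => deriv (fun t => f t y z) x,
    fun x y z => deriv (fun t => f x t z) y,
    fun x y z => deriv (fun t => f x y t) z] i

/-- Hessian matrix of second-order partial derivatives at `(x, y, z)`. -/
noncomputable def Hess (f : ℝ → ℝ → ℝ → ℝ) (x y z : ℝ) : Matrix (Fin 3) (Fin 3) ℝ :=
  Matrix.of fun i j => pd i (pd j f) x y z

/-- The point `(x, y, z)` with its `i`-th coordinate replaced by `t`, fed to `f`. -/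
def slice (i : Fin 3) (f : ℝ → ℝ → ℝ → ℝ) (x y z t : ℝ) : ℝ :=
  ![f t y z, f x t z, f x y t] i

/-- The `i`-th coordinate of `(x, y, z)`. -/
def coord (i : Fin 3) (x y z : ℝ) : ℝ := ![x, y, z] i

lemma pd_eq_deriv_slice (i : Fin 3) (f : ℝ → ℝ → ℝ → ℝ) (x y z : ℝ) :
    pd i f x y z = deriv (slice i f x y z) (coord i x y z) := by
  fin_cases i <;> rfl

lemma slice_coord (i : Fin 3) (f : ℝ → ℝ → ℝ → ℝ) (x y z : ℝ) :
    slice i f x y z (coord i x y z) = f x y z := by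
  fin_cases i <;> rfl

lemma slice_zero (f : ℝ → ℝ → ℝ → ℝ) (x y z : ℝ) : slice 0 f x y z = fun t => f t y z := rfl

lemma slice_one (f : ℝ → ℝ → ℝ → ℝ) (x y z : ℝ) : slice 1 f x y z = fun t => f x t z := rfl

lemma slice_two (f : ℝ → ℝ → ℝ → ℝ) (x y z : ℝ) : slice 2 f x y z = fun t => f x y t := rfl

/-- The determinant factor `x1·x2 − x4²`. -/
def detFactor (x y z : ℝ) : ℝ := x * y - z ^ 2

/-- The numerator of the scalar curvature at `x3 = 1`. -/
def scalNum (x y z : ℝ) : ℝ :=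
  y ^ 2 + x ^ 2 * (4 * y ^ 2 - 8 * y + 1) + 8 * y * z ^ 2 + 8 * x * (z ^ 2 - y ^ 2)
    - 2 * z ^ 2 * (1 + 2 * z ^ 2)

/-- Gradient of `detFactor`. -/
def detFactorGrad (j : Fin 3) (x y z : ℝ) : ℝ := ![y, x, -2 * z] j

/-- Gradient of `scalNum`. -/
def scalNumGrad (j : Fin 3) (x y z : ℝ) : ℝ :=
  ![2 * x * (4 * y ^ 2 - 8 * y + 1) + 8 * (z ^ 2 - y ^ 2),
    2 * y + x ^ 2 * (8 * y - 8) + 8 * z ^ 2 - 16 * x * y,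
    16 * y * z + 16 * x * z - 4 * z - 16 * z ^ 3] j

/-- Hessian of `detFactor`. -/
def detFactorHess : Matrix (Fin 3) (Fin 3) ℝ := !![0, 1, 0; 1, 0, 0; 0, 0, -2]

/-- Hessian of `scalNum` at `(1/2, 3/2, 1/2)`. -/
def scalNumHess : Matrix (Fin 3) (Fin 3) ℝ := !![-4, -20, 8; -20, -4, 8; 8, 8, 16]

/-- The `j`-th partial derivative of `F` multiplied by `detFactor ^ (3 - p)`. -/
noncomputable def gradNum (d n p : ℝ) (j : Fin 3) (x y z : ℝ) : ℝ :=
  d / 2 * p * detFactorGrad j x y z * detFactor x y z ^ 2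
    - n / 16 * (scalNumGrad j x y z * detFactor x y z
      + (p - 2) * scalNum x y z * detFactorGrad j x y z)

lemma hasDerivAt_slice_detFactor (i : Fin 3) (x y z : ℝ) :
    HasDerivAt (slice i detFactor x y z) (detFactorGrad i x y z) (coord i x y z) := by
  fin_cases i
  all_goals
    simp only [slice_zero, slice_one, slice_two, coord, detFactor, detFactorGrad, Fin.zero_eta, Fin.mk_one,
      Fin.reduceFinMk, Matrix.cons_val]
    refine (DifferentiableAt.hasDerivAt (by fun_prop)).congr_deriv ?_
    simp (disch := fun_prop)

lemma hasDerivAt_slice_scalNum (i : Fin 3) (x y z : ℝ) :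
    HasDerivAt (slice i scalNum x y z) (scalNumGrad i x y z) (coord i x y z) := by
  fin_cases i
  all_goals
    simp only [slice_zero, slice_one, slice_two, coord, scalNum, scalNumGrad, Fin.zero_eta, Fin.mk_one,
      Fin.reduceFinMk, Matrix.cons_val]
    refine (DifferentiableAt.hasDerivAt (by fun_prop)).congr_deriv ?_
    simp (disch := fun_prop) [deriv_fun_mul, deriv_fun_add, deriv_fun_sub, deriv_fun_pow]
    try ring

lemma hasDerivAt_slice_detFactorGrad (i j : Fin 3) (x y z : ℝ) :
    HasDerivAt (slice i (detFactorGrad j) x y z) (detFactorHess i j) (coord i x y z) := by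
  fin_cases i <;> fin_cases j
  all_goals
    simp only [slice_zero, slice_one, slice_two, coord, detFactorHess, detFactorGrad, Fin.zero_eta, Fin.mk_one,
      Fin.reduceFinMk, Matrix.cons_val, Matrix.of_apply]
    refine (DifferentiableAt.hasDerivAt (by fun_prop)).congr_deriv ?_
    simp (disch := fun_prop)

lemma hasDerivAt_slice_scalNumGrad (i j : Fin 3) :
    HasDerivAt (slice i (scalNumGrad j) (1/2) (3/2) (1/2)) (scalNumHess i j)
      (coord i (1/2) (3/2) (1/2)) := by
  fin_cases i <;> fin_cases j
  all_goals
    simp only [slice_zero, slice_one, slice_two, coord, scalNumHess, scalNumGrad, Fin.zero_eta, Fin.mk_one,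
      Fin.reduceFinMk, Matrix.cons_val, Matrix.of_apply]
    refine (DifferentiableAt.hasDerivAt (by fun_prop)).congr_deriv ?_
    simp (disch := fun_prop) [deriv_fun_mul, deriv_fun_add, deriv_fun_sub, deriv_fun_pow]
    try norm_num

lemma F_eq (d n x y z : ℝ) (h : 0 < detFactor x y z) :
    F d n x y z = d / 2 * detFactor x y z ^ (n / (d + 2 * n))
      - n / 16 * (scalNum x y z * detFactor x y z ^ (n / (d + 2 * n) - 2)) := by
  have h' : 0 < x * y - z ^ 2 := h
  rw [Real.rpow_sub h, Real.rpow_two]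
  simp only [F, Scal, scalNum, detFactor]
  rw [show (z ^ 2 - x * y) ^ 2 = (x * y - z ^ 2) ^ 2 by ring]
  field_simp

lemma eventually_detFactor_pos (i : Fin 3) (x y z : ℝ) (h : 0 < detFactor x y z) :
    ∀ᶠ t in nhds (coord i x y z), 0 < slice i detFactor x y z t := by
  refine (hasDerivAt_slice_detFactor i x y z).continuousAt.eventually_const_lt ?_
  rwa [slice_coord]

lemma pd_F (d n : ℝ) (j : Fin 3) (x y z : ℝ) (h : 0 < detFactor x y z) :
    pd j (F d n) x y z =
      gradNum d n (n / (d + 2 * n)) j x y z * detFactor x y z ^ (n / (d + 2 * n) - 3) := by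
  set p := n / (d + 2 * n) with hp
  have hD := hasDerivAt_slice_detFactor j x y z
  have hN := hasDerivAt_slice_scalNum j x y z
  have h0 : slice j detFactor x y z (coord j x y z) ≠ 0 := by
    rw [slice_coord]; exact h.ne'
  have key := ((hD.rpow_const (p := p) (Or.inl h0)).const_mul (d / 2)).sub
    ((hN.mul (hD.rpow_const (p := p - 2) (Or.inl h0))).const_mul (n / 16))
  rw [pd_eq_deriv_slice]
  have hev : slice j (F d n) x y z =ᶠ[nhds (coord j x y z)] fun t =>
      d / 2 * slice j detFactor x y z t ^ p
        - n / 16 * (slice j scalNum x y z t * slice j detFactor x y z t ^ (p - 2)) := by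
    filter_upwards [eventually_detFactor_pos j x y z h] with t ht
    fin_cases j <;> exact F_eq _ _ _ _ _ ht
  rw [hev.deriv_eq]
  refine key.deriv.trans ?_
  simp only [slice_coord, gradNum]
  have e1 : detFactor x y z ^ (p - 1) = detFactor x y z ^ (p - 3) * detFactor x y z ^ 2 := by
    rw [← Real.rpow_two, ← Real.rpow_add h]; ring_nf
  have e2 : detFactor x y z ^ (p - 2) = detFactor x y z ^ (p - 3) * detFactor x y z := by
    nth_rw 3 [← Real.rpow_one (detFactor x y z)]
    rw [← Real.rpow_add h]; ring_nf
  rw [show p - 2 - 1 = p - 3 by ring, e1, e2]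
  ring

/-- The Hessian of `F` at `(1/2, 3/2, 1/2)`, up to a positive scalar, where `p = n/(d+2n)`. -/
noncomputable def hessModel (p : ℝ) : Matrix (Fin 3) (Fin 3) ℝ :=
  !![1 - 9 * ((1 + p) / 2), 2 - 3 * ((1 + p) / 2), -2 + 6 * ((1 + p) / 2);
     2 - 3 * ((1 + p) / 2), 1 - (1 + p) / 2, -2 + 2 * ((1 + p) / 2);
     -2 + 6 * ((1 + p) / 2), -2 + 2 * ((1 + p) / 2), 2 - 4 * ((1 + p) / 2)]

lemma Hess_F (d n : ℝ) (hd : 0 < d) (hn : 0 < n) :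
    Hess (F d n) (1/2) (3/2) (1/2) =
      (n * (1 / 2 : ℝ) ^ (n / (d + 2 * n))) • hessModel (n / (d + 2 * n)) := by
  have hdp : d * (n / (d + 2 * n)) = n - 2 * n * (n / (d + 2 * n)) := by
    field_simp; ring
  set p := n / (d + 2 * n) with hp
  have hval : detFactor (1/2) (3/2) (1/2) = 1 / 2 := by norm_num [detFactor]
  have hpos : 0 < detFactor (1/2) (3/2) (1/2) := by rw [hval]; norm_num
  ext i j
  have hD := hasDerivAt_slice_detFactor i (1/2) (3/2) (1/2)
  have hN := hasDerivAt_slice_scalNum i (1/2) (3/2) (1/2)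
  have hDj := hasDerivAt_slice_detFactorGrad i j (1/2) (3/2) (1/2)
  have hNj := hasDerivAt_slice_scalNumGrad i j
  have h0 : slice i detFactor (1/2) (3/2) (1/2) (coord i (1/2) (3/2) (1/2)) ≠ 0 := by
    rw [slice_coord]; exact hpos.ne'
  have key := (((hDj.const_mul (d / 2 * p)).mul (hD.pow 2)).sub
    (((hNj.mul hD).add ((hN.const_mul (p - 2)).mul hDj)).const_mul (n / 16))).mul
    (hD.rpow_const (p := p - 3) (Or.inl h0))
  have hev : slice i (pd j (F d n)) (1/2) (3/2) (1/2) =ᶠ[nhds (coord i (1/2) (3/2) (1/2))]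
      fun t => (d / 2 * p * slice i (detFactorGrad j) (1/2) (3/2) (1/2) t
          * slice i detFactor (1/2) (3/2) (1/2) t ^ 2
        - n / 16 * (slice i (scalNumGrad j) (1/2) (3/2) (1/2) t
            * slice i detFactor (1/2) (3/2) (1/2) t
          + (p - 2) * slice i scalNum (1/2) (3/2) (1/2) t
            * slice i (detFactorGrad j) (1/2) (3/2) (1/2) t))
        * slice i detFactor (1/2) (3/2) (1/2) t ^ (p - 3) := by
    filter_upwards [eventually_detFactor_pos i _ _ _ hpos] with t ht
    fin_cases i <;> exact pd_F _ _ _ _ _ _ ht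
  rw [Hess, Matrix.of_apply, pd_eq_deriv_slice, hev.deriv_eq]
  refine key.deriv.trans ?_
  have e3 : (1 / 2 : ℝ) ^ (p - 3) = 8 * (1 / 2 : ℝ) ^ p := by
    rw [Real.rpow_sub (by norm_num), show (3 : ℝ) = (3 : ℕ) by norm_num, Real.rpow_natCast]
    ring
  have e4 : (1 / 2 : ℝ) ^ (p - 3 - 1) = 16 * (1 / 2 : ℝ) ^ p := by
    rw [show p - 3 - 1 = p - 4 by ring, Real.rpow_sub (by norm_num),
      show (4 : ℝ) = (4 : ℕ) by norm_num, Real.rpow_natCast]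
    ring
  have hNval : scalNum (1/2) (3/2) (1/2) = -4 := by norm_num [scalNum]
  simp only [Pi.mul_apply, Pi.add_apply, Pi.sub_apply, Pi.pow_apply, slice_coord, hval, hNval,
    e3, e4, Matrix.smul_apply, smul_eq_mul]
  generalize (1 / 2 : ℝ) ^ p = c
  fin_cases i <;> fin_cases j
  all_goals
    simp only [detFactorGrad, scalNumGrad, detFactorHess, scalNumHess, hessModel,
      Fin.zero_eta, Fin.mk_one, Fin.reduceFinMk, Matrix.cons_val, Matrix.of_apply]
    grind

/-- A real symmetric `3 × 3` matrix with positive determinant and negative trace has exactly one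
positive and two negative eigenvalues. -/
lemma Matrix.IsHermitian.card_roots_of_det_pos_of_trace_neg {A : Matrix (Fin 3) (Fin 3) ℝ}
    (hA : A.IsHermitian) (hdet : 0 < A.det) (htr : A.trace < 0) :
    (A.charpoly.roots.filter (fun x => 0 < x)).card = 1 ∧
    (A.charpoly.roots.filter (fun x => x < 0)).card = 2 := by
  rw [hA.det_eq_prod_eigenvalues] at hdet
  rw [hA.trace_eq_sum_eigenvalues] at htr
  rw [hA.roots_charpoly_eq_eigenvalues]
  simp only [Fin.prod_univ_three, Fin.sum_univ_three, RCLike.ofReal_real_eq_id, id] at hdet htr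
  have hmap : Multiset.map (RCLike.ofReal ∘ hA.eigenvalues) Finset.univ.val
      = {hA.eigenvalues 0, hA.eigenvalues 1, hA.eigenvalues 2} := rfl
  rw [hmap]
  generalize hA.eigenvalues 0 = a at *
  generalize hA.eigenvalues 1 = b at *
  generalize hA.eigenvalues 2 = c at *
  rcases lt_trichotomy a 0 with ha | rfl | ha
  · rcases lt_trichotomy b 0 with hb | rfl | hb
    · have hc : 0 < c := (pos_iff_pos_of_mul_pos hdet).1 (mul_pos_of_neg_of_neg ha hb)
      simp [Multiset.filter_singleton, ha, hb, hc, ha.not_gt, hb.not_gt,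
        hc.not_gt]
    · simp at hdet
    · have hc : c < 0 := by
        by_contra! hc
        exact hdet.not_ge (mul_nonpos_of_nonpos_of_nonneg (mul_neg_of_neg_of_pos ha hb).le hc)
      simp [Multiset.filter_singleton, ha, hb, hc, ha.not_gt, hb.not_gt,
        hc.not_gt]
  · simp at hdet
  · have hbc : 0 < b * c := by
      rw [mul_assoc] at hdet
      exact (pos_iff_pos_of_mul_pos hdet).1 ha
    rcases lt_or_ge b 0 with hb | hb
    · have hc : c < 0 := by
        by_contra! hc
        exact hbc.not_ge (mul_nonpos_of_nonpos_of_nonneg hb.le hc)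
      simp [Multiset.filter_singleton, ha, hb, hc, ha.not_gt, hb.not_gt,
        hc.not_gt]
    · have hc : 0 < c := (pos_iff_pos_of_mul_pos hbc).1 (hb.lt_of_ne (by rintro rfl; simp at hbc))
      linarith

/-- The Hessian of `F` at `(1/2, 3/2, 1/2)` is a real symmetric matrix having exactly
one positive eigenvalue and exactly two negative eigenvalues (counted with multiplicity,
as roots of the characteristic polynomial): the Einstein metric `g5` is a non-degenerate
unstable critical point of the normalized scalar curvature of coindex 1. -/
theorem g5_coindex_one (d n : ℝ) (hd : 0 < d) (hn : 0 < n) :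
    (Hess (F d n) (1/2) (3/2) (1/2)).IsHermitian ∧
    ((Hess (F d n) (1/2) (3/2) (1/2)).charpoly.roots.filter (fun x => 0 < x)).card = 1 ∧
    ((Hess (F d n) (1/2) (3/2) (1/2)).charpoly.roots.filter (fun x => x < 0)).card = 2 := by
  rw [Hess_F d n hd hn]
  have hp : 0 < n / (d + 2 * n) := by positivity
  have hc : 0 < n * (1 / 2 : ℝ) ^ (n / (d + 2 * n)) := by positivity
  generalize n * (1 / 2 : ℝ) ^ (n / (d + 2 * n)) = c at hc
  generalize n / (d + 2 * n) = p at hp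
  have hH : (c • hessModel p).IsHermitian := by
    ext i j
    fin_cases i <;> fin_cases j <;> simp [hessModel]
  refine ⟨hH, hH.card_roots_of_det_pos_of_trace_neg ?_ ?_⟩
  · have : (hessModel p).det = 2 := by
      rw [Matrix.det_fin_three]
      simp only [hessModel, Matrix.cons_val, Matrix.of_apply]
      ring
    rw [Matrix.det_smul, this]
    positivity
  · have : (hessModel p).trace = -3 - 7 * p := by
      rw [Matrix.trace_fin_three]
      simp only [hessModel, Matrix.cons_val, Matrix.of_apply]
      ring
    rw [Matrix.trace_smul, this, smul_eq_mul]
    exact mul_neg_of_pos_of_neg hc (by linarith)
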